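/- arXiv:1011.3142 — 2 statements merged into one kernel-verified Lean document; each statement's English description precedes it below -/
import Mathlib

section
/- Let F be a field of characteristic not 2 with involution a ↦ ā (possibly the identity), let p(x) = p^∨(x) be a polynomial irreducible over F, and consider the field F(κ) = F[x]/p(x)F[x] with κ the class of x, equipped with the involution f(κ)° := f̄(κ⁻¹). Then each element of F(κ) fixed by this involution is uniquely representable in the form q(κ), where q(x) = a_r x^r + ⋯ + a_1 x + a_0 + ā_1 x⁻¹ + ⋯ + ā_r x⁻ʳ with a₀ = ā₀, r = ⌊deg p(x)/2⌋, a₀,…,a_r ∈ F, and, if deg p(x) is even: a_r = 0 if the involution on F is the identity; a_r = ā_r if the involution on F is not the identity and p(0) ≠ 1; a_r = −ā_r if the involution on F is not the identity and p(0) = 1. -/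
open Polynomial Matrix

namespace Can

noncomputable section

abbrev Mat (F : Type*) (n : ℕ) := Matrix (Fin n) (Fin n) F

variable {F : Type*} [Field F]

/-- conjugate transpose w.r.t. an involution σ -/
def ctr (σ : F →+* F) {m n : ℕ} (A : Matrix (Fin m) (Fin n) F) : Matrix (Fin n) (Fin m) F :=
  (A.map σ)ᵀ

/-- congruence: SᵀAS = B for a nonsingular S -/
def Congruent {n : ℕ} (A B : Mat F n) : Prop :=
  ∃ S : Mat F n, IsUnit S.det ∧ Sᵀ * A * S = B

/-- *congruence: S*AS = B for a nonsingular S -/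
def StarCongruent (σ : F →+* F) {n : ℕ} (A B : Mat F n) : Prop :=
  ∃ S : Mat F n, IsUnit S.det ∧ ctr σ S * A * S = B

/-- a square-matrix "summand" of unspecified size -/
abbrev Block (F : Type*) := Σ n : ℕ, Mat F n

def castMat {m n : ℕ} (h : m = n) (A : Mat F m) : Mat F n :=
  Matrix.reindex (finCongr h) (finCongr h) A

def BCong (X Y : Block F) : Prop :=
  ∃ h : X.1 = Y.1, Congruent (castMat h X.2) Y.2

def BStarCong (σ : F →+* F) (X Y : Block F) : Prop :=
  ∃ h : X.1 = Y.1, StarCongruent σ (castMat h X.2) Y.2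

/-- direct sum of a list of blocks -/
def bsum : List (Block F) → Block F
  | [] => ⟨0, 0⟩
  | X :: L => ⟨X.1 + (bsum L).1,
      Matrix.reindex finSumFinEquiv finSumFinEquiv (Matrix.fromBlocks X.2 0 0 (bsum L).2)⟩

/-- pairs of square matrices of the same size -/
abbrev PBlock (F : Type*) := Σ n : ℕ, Mat F n × Mat F n

def PCong (X Y : PBlock F) : Prop :=
  ∃ h : X.1 = Y.1, ∃ S : Mat F Y.1, IsUnit S.det ∧
    Sᵀ * castMat h X.2.1 * S = Y.2.1 ∧ Sᵀ * castMat h X.2.2 * S = Y.2.2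

def PStarCong (σ : F →+* F) (X Y : PBlock F) : Prop :=
  ∃ h : X.1 = Y.1, ∃ S : Mat F Y.1, IsUnit S.det ∧
    ctr σ S * castMat h X.2.1 * S = Y.2.1 ∧ ctr σ S * castMat h X.2.2 * S = Y.2.2

def psum : List (PBlock F) → PBlock F
  | [] => ⟨0, (0, 0)⟩
  | X :: L =>
      ⟨X.1 + (psum L).1,
        (Matrix.reindex finSumFinEquiv finSumFinEquiv (Matrix.fromBlocks X.2.1 0 0 (psum L).2.1),
         Matrix.reindex finSumFinEquiv finSumFinEquiv (Matrix.fromBlocks X.2.2 0 0 (psum L).2.2))⟩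

/-- lower-triangular Jordan block -/
def J (F : Type*) [Field F] (n : ℕ) (lam : F) : Mat F n :=
  Matrix.of fun i j => if i = j then lam else if (i : ℕ) = (j : ℕ) + 1 then 1 else 0

/-- the companion (Frobenius) matrix of a polynomial -/
def companion (F : Type*) [Field F] (f : Polynomial F) : Mat F f.natDegree :=
  Matrix.of fun i j => if (i : ℕ) = (j : ℕ) + 1 then 1
    else if (j : ℕ) + 1 = f.natDegree then -f.coeff i else 0

/-- f ↦ f^∨ (with respect to the involution σ) -/
def dualPoly (σ : F →+* F) (f : Polynomial F) : Polynomial F :=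
  Polynomial.C (σ (f.coeff 0))⁻¹ * (f.map σ).reverse

/-- the skew sum [A ⟍ B] = [[0, B], [A, 0]] -/
def skewSum {k l : ℕ} (A : Matrix (Fin k) (Fin l) F) (B : Matrix (Fin l) (Fin k) F) :
    Mat F (l + k) :=
  Matrix.reindex finSumFinEquiv finSumFinEquiv (Matrix.fromBlocks 0 B A 0)

/-- the matrix Γₙ -/
def Gamma (F : Type*) [Field F] (n : ℕ) : Mat F n :=
  Matrix.of fun i j =>
    if (i : ℕ) + (j : ℕ) + 1 = n ∨ (i : ℕ) + (j : ℕ) = n then (-1 : F) ^ (n - 1 - (i : ℕ)) else 0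

/-- Fₙ = [I | 0], an (n−1)×n matrix -/
def Fmat (F : Type*) [Field F] (n : ℕ) : Matrix (Fin (n - 1)) (Fin n) F :=
  Matrix.of fun i j => if (i : ℕ) = (j : ℕ) then 1 else 0

/-- Gₙ = [0 | I], an (n−1)×n matrix -/
def Gmat (F : Type*) [Field F] (n : ℕ) : Matrix (Fin (n - 1)) (Fin n) F :=
  Matrix.of fun i j => if (i : ℕ) + 1 = (j : ℕ) then 1 else 0

/-- the pair Bₙ of symmetric n×n matrices -/
def Bpair (F : Type*) [Field F] (n : ℕ) : Mat F n × Mat F n :=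
  (Matrix.of fun i j => if (i : ℕ) + (j : ℕ) + 2 = n then 1 else 0,
   Matrix.of fun i j => if (i : ℕ) + (j : ℕ) + 1 = n then 1 else 0)

/-- the pair Cₙ of a symmetric and a skew-symmetric n×n matrix -/
def Cpair (F : Type*) [Field F] (n : ℕ) : Mat F n × Mat F n :=
  if Odd n then
    (Matrix.of fun i j => if (i : ℕ) + (j : ℕ) + 1 = n then 1 else 0,
     Matrix.of fun i j =>
       if (i : ℕ) + (j : ℕ) + 2 = n ∧ i < j then 1
       else if (i : ℕ) + (j : ℕ) + 2 = n ∧ j < i then -1 else 0)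
  else
    (Matrix.of fun i j => if (i : ℕ) + (j : ℕ) + 2 = n then 1 else 0,
     Matrix.of fun i j =>
       if (i : ℕ) + (j : ℕ) + 1 = n ∧ i < j then 1
       else if (i : ℕ) + (j : ℕ) + 1 = n ∧ j < i then -1 else 0)

/-- at most one entry of the list satisfies P -/
def AtMostOne {α : Type*} (P : α → Prop) (L : List α) : Prop :=
  ¬ ∃ b₁ b₂ : α, List.Sublist [b₁, b₂] L ∧ P b₁ ∧ P b₂


section Stmt16
variable {F : Type*} [Field F]

theorem pow_mul_symm_laurent {K : Type*} [CommRing K] (a b : ℕ → K) {k w : K} (h : w * k = 1)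
    (r : ℕ) :
    k ^ r * (a 0 + ∑ i ∈ Finset.Icc 1 r, (a i * k ^ i + b i * w ^ i)) =
      ∑ j ∈ Finset.range (2 * r + 1), (if r ≤ j then a (j - r) else b (r - j)) * k ^ j := by
  induction r with
  | zero => simp
  | succ r ih =>
    have hw : w ^ (r + 1) * k ^ (r + 1) = 1 := by rw [← mul_pow, h, one_pow]
    have hsum : ∑ j ∈ Finset.range (2 * r + 1),
        (if r + 1 ≤ j + 1 then a (j + 1 - (r + 1)) else b (r + 1 - (j + 1))) * k ^ (j + 1) =
        k * ∑ j ∈ Finset.range (2 * r + 1),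
          (if r ≤ j then a (j - r) else b (r - j)) * k ^ j := by
      rw [Finset.mul_sum]
      refine Finset.sum_congr rfl fun j _ => ?_
      simp only [Nat.add_sub_add_right, add_le_add_iff_right]
      ring
    rw [show 2 * (r + 1) + 1 = (2 * r + 1 + 1) + 1 by ring, Finset.sum_range_succ,
      Finset.sum_range_succ', hsum, ← ih, Finset.sum_Icc_succ_top (by omega)]
    rw [if_neg (by omega : ¬ r + 1 ≤ 0), if_pos (by omega : r + 1 ≤ 2 * r + 1 + 1),
      show 2 * r + 1 + 1 - (r + 1) = r + 1 by omega, Nat.sub_zero]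
    linear_combination b (r + 1) * hw

/-- The polynomial `x ^ r * q(x)` for the Laurent polynomial
`q(x) = a 0 + ∑ (a i * x ^ i + σ (a i) * x ^ (-i))`, the sum being over `1 ≤ i ≤ r`. -/
def symmPoly (σ : F →+* F) (a : ℕ → F) (r : ℕ) : F[X] :=
  ∑ j ∈ Finset.range (2 * r + 1), C (if r ≤ j then a (j - r) else σ (a (r - j))) * X ^ j

theorem coeff_symmPoly (σ : F →+* F) (a : ℕ → F) (r j : ℕ) :
    (symmPoly σ a r).coeff j =
      if j ≤ 2 * r then (if r ≤ j then a (j - r) else σ (a (r - j))) else 0 := by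
  simp only [symmPoly, finsetSum_coeff, coeff_C_mul_X_pow, Finset.sum_ite_eq, Finset.mem_range,
    Nat.lt_succ_iff]

theorem aeval_symmPoly {K : Type*} [CommRing K] [Algebra F K] (σ : F →+* F) (a : ℕ → F) {k w : K}
    (h : w * k = 1) (r : ℕ) :
    aeval k (symmPoly σ a r) = k ^ r * (algebraMap F K (a 0) + ∑ i ∈ Finset.Icc 1 r,
      (algebraMap F K (a i) * k ^ i + algebraMap F K (σ (a i)) * w ^ i)) := by
  rw [pow_mul_symm_laurent (fun i => algebraMap F K (a i)) (fun i => algebraMap F K (σ (a i))) h,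
    symmPoly, map_sum]
  refine Finset.sum_congr rfl fun j _ => ?_
  split_ifs <;> simp

theorem eq_symmPoly {σ : F →+* F} {Q : F[X]} {r : ℕ} (hdeg : Q.natDegree ≤ 2 * r)
    (hsymm : ∀ j ≤ 2 * r, σ (Q.coeff (2 * r - j)) = Q.coeff j) :
    Q = symmPoly σ (fun i => Q.coeff (r + i)) r := by
  ext j
  rw [coeff_symmPoly]
  split_ifs with h1 h2
  · congr 1
    omega
  · rw [← hsymm j h1]
    congr 2
    omega
  · exact coeff_eq_zero_of_natDegree_lt (by omega)

/-- Evaluation of the conjugate reciprocal polynomial. -/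
theorem aeval_reflect_map {K : Type*} [CommRing K] [Algebra F K] {σ : F →+* F} {τ : K ≃+* K}
    (hτF : ∀ a : F, τ (algebraMap F K a) = algebraMap F K (σ a)) {k : K} (hk : τ k * k = 1)
    {N : ℕ} {Q : F[X]} (hdeg : Q.natDegree ≤ N) :
    aeval k (reflect N (Q.map σ)) = k ^ N * τ (aeval k Q) := by
  let _ : Invertible (τ k) := ⟨k, by rw [mul_comm, hk], hk⟩
  have h := eval₂_reflect_mul_pow (algebraMap F K) (τ k) N (Q.map σ)
    (natDegree_map_le.trans hdeg)
  have hev : eval₂ (algebraMap F K) (τ k) (Q.map σ) = τ (aeval k Q) := by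
    rw [eval₂_map, aeval_def, ← RingEquiv.coe_toRingHom, hom_eval₂]
    congr 1
    ext a
    simp [hτF]
  have hpow : τ k ^ N * k ^ N = 1 := by rw [← mul_pow, hk, one_pow]
  rw [hev] at h
  rw [← h, aeval_def]
  change _ = k ^ N * (eval₂ (algebraMap F K) k _ * τ k ^ N)
  linear_combination (-eval₂ (algebraMap F K) k (reflect N (Q.map σ))) * hpow

theorem map_coeff_of_dualPoly_eq {σ : F →+* F} {P : F[X]} (hns : P.coeff 0 ≠ 0)
    (hself : dualPoly σ P = P) {j : ℕ} (hj : j ≤ P.natDegree) :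
    σ (P.coeff (P.natDegree - j)) = σ (P.coeff 0) * P.coeff j := by
  have h0 : σ (P.coeff 0) ≠ 0 := by simpa using hns
  have h := congrArg (fun Q => Polynomial.coeff Q j) hself
  simp only [dualPoly, coeff_C_mul, coeff_reverse, natDegree_map, revAt_le hj, coeff_map] at h
  rw [← h, mul_inv_cancel_left₀ h0]

theorem monic_of_dualPoly_eq {σ : F →+* F} {P : F[X]} (hns : P.coeff 0 ≠ 0)
    (hself : dualPoly σ P = P) : P.Monic := by
  have h0 : σ (P.coeff 0) ≠ 0 := by simpa using hns
  have h := map_coeff_of_dualPoly_eq hns hself le_rfl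
  rw [Nat.sub_self] at h
  exact (mul_eq_left₀ h0).1 h.symm

/-- A symmetric polynomial representative of `κ ^ r * z`, for `z` fixed by the involution. -/
theorem exists_symm_representative (hchar : (2 : F) ≠ 0) {σ : F →+* F}
    (hσinv : ∀ a, σ (σ a) = a) {P : F[X]} (hP : P.Monic) (hP1 : P ≠ 1)
    {τ : AdjoinRoot P ≃+* AdjoinRoot P}
    (hτF : ∀ a : F, τ (algebraMap F (AdjoinRoot P) a) = algebraMap F (AdjoinRoot P) (σ a))
    (hτκ : τ (AdjoinRoot.root P) * AdjoinRoot.root P = 1)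
    {z : AdjoinRoot P} (hz : τ z = z) {r : ℕ} (hr : P.natDegree ≤ 2 * r + 1) :
    ∃ Q : F[X], Q.natDegree ≤ 2 * r ∧ (∀ j ≤ 2 * r, σ (Q.coeff (2 * r - j)) = Q.coeff j) ∧
      aeval (AdjoinRoot.root P) Q = AdjoinRoot.root P ^ r * z := by
  set k := AdjoinRoot.root P with hk
  obtain ⟨Q₁, hQ₁⟩ := AdjoinRoot.mk_surjective (k ^ r * z)
  set Q₀ := Q₁ %ₘ P with hQ₀
  have hdeg : Q₀.natDegree ≤ 2 * r := by
    have : Q₀.natDegree < P.natDegree := natDegree_modByMonic_lt Q₁ hP hP1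
    omega
  have hQ₀k : aeval k Q₀ = k ^ r * z := by
    rw [← hQ₁, hQ₀, hk, AdjoinRoot.aeval_eq, AdjoinRoot.mk_eq_mk]
    exact ⟨-(Q₁ /ₘ P), by linear_combination modByMonic_add_div Q₁ P⟩
  have hdeg' : (reflect (2 * r) (Q₀.map σ)).natDegree ≤ 2 * r := by
    rw [natDegree_le_iff_coeff_eq_zero]
    intro N hN
    rw [coeff_reflect, revAt_eq_self_of_lt hN, coeff_map,
      coeff_eq_zero_of_natDegree_lt (by omega), map_zero]
  have hrefl : aeval k (reflect (2 * r) (Q₀.map σ)) = k ^ r * z := by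
    have hpow : τ k ^ r * k ^ r = 1 := by rw [← mul_pow, hτκ, one_pow]
    rw [aeval_reflect_map hτF hτκ hdeg, hQ₀k, map_mul, map_pow, hz]
    linear_combination k ^ r * z * hpow
  refine ⟨C 2⁻¹ * (Q₀ + reflect (2 * r) (Q₀.map σ)), ?_, ?_, ?_⟩
  · exact (natDegree_C_mul_le _ _).trans (natDegree_add_le_of_degree_le hdeg hdeg')
  · intro j hj
    simp only [coeff_C_mul, coeff_add, coeff_reflect, coeff_map, revAt_le hj,
      revAt_le (Nat.sub_le (2 * r) j), Nat.sub_sub_self hj, map_mul, map_add, hσinv, map_inv₀,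
      map_ofNat]
    ring
  · have h2 : algebraMap F (AdjoinRoot P) 2⁻¹ * 2 = 1 := by
      rw [← map_ofNat (algebraMap F (AdjoinRoot P)) 2, ← map_mul, inv_mul_cancel₀ hchar, map_one]
    rw [map_mul, map_add, aeval_C, hrefl, hQ₀k]
    linear_combination k ^ r * z * h2

/-- A symmetric Laurent polynomial vanishing at `κ` is zero as soon as its top coefficient is, and
in the even case the latter is constrained by `P.coeff 0`. -/
theorem eq_zero_of_aeval_symmPoly_eq_zero {σ : F →+* F} {P : F[X]} (hP : P.Monic) {d : ℕ → F}
    (h0 : aeval (AdjoinRoot.root P) (symmPoly σ d (P.natDegree / 2)) = 0)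
    (htop : Even P.natDegree → P.natDegree ≠ 0 →
      σ (d (P.natDegree / 2)) = d (P.natDegree / 2) * P.coeff 0 → d (P.natDegree / 2) = 0)
    (hpos : P.natDegree ≠ 0) {i : ℕ} (hi : i ≤ P.natDegree / 2) : d i = 0 := by
  set r := P.natDegree / 2 with hr
  rw [AdjoinRoot.aeval_eq, AdjoinRoot.mk_eq_zero] at h0
  suffices hL : symmPoly σ d r = 0 by
    have h := congrArg (fun Q => Polynomial.coeff Q (r + i)) hL
    simpa [coeff_symmPoly, show r + i ≤ 2 * r by omega] using h
  have hdeg : (symmPoly σ d r).natDegree ≤ 2 * r := by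
    rw [natDegree_le_iff_coeff_eq_zero]
    intro N hN
    rw [coeff_symmPoly, if_neg (by omega)]
  obtain ⟨R, hR⟩ := h0
  by_contra hne
  have hR0 : R ≠ 0 := by
    rintro rfl
    exact hne (by rw [hR, mul_zero])
  have hnat := hP.natDegree_mul' hR0
  rw [← hR] at hnat
  have hn : P.natDegree = 2 * r := by omega
  have hRC : R = C (R.coeff 0) := eq_C_of_natDegree_eq_zero (by omega)
  have ht : d r = R.coeff 0 := by
    have h := congrArg (fun Q => Polynomial.coeff Q (2 * r)) hR
    beta_reduce at h
    rw [hRC, coeff_mul_C, ← hn, hP.coeff_natDegree, hn, coeff_symmPoly, if_pos le_rfl,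
      if_pos (by omega), one_mul, show 2 * r - r = r by omega] at h
    exact h
  have hb : σ (d r) = d r * P.coeff 0 := by
    have h := congrArg (fun Q => Polynomial.coeff Q 0) hR
    beta_reduce at h
    rw [hRC, coeff_mul_C, coeff_symmPoly, if_pos (by omega), if_neg (by omega), Nat.sub_zero,
      ← ht, mul_comm] at h
    exact h
  have hd0 := htop (hn ▸ even_two_mul r) hpos hb
  exact hR0 (by rw [hRC, ← ht, hd0, map_zero])

/-- With identity involution, a self-dual irreducible polynomial of even degree has constant
term one. -/
theorem coeff_zero_eq_one_of_even (hchar : (2 : F) ≠ 0) {P : F[X]} (hirr : Irreducible P)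
    (hns : P.coeff 0 ≠ 0) (hself : dualPoly (RingHom.id F) P = P) (heven : Even P.natDegree) :
    P.coeff 0 = 1 := by
  have hP := monic_of_dualPoly_eq hns hself
  have hsq : P.coeff 0 * P.coeff 0 = 1 := by
    have h := map_coeff_of_dualPoly_eq hns hself (Nat.zero_le _)
    simpa [hP.coeff_natDegree] using h.symm
  rcases mul_self_eq_one_iff.1 hsq with h1 | h1
  · exact h1
  · exfalso
    have heval : P.eval 1 = 0 := by
      have h := congrArg (Polynomial.eval 1) hself
      have hrev : P.reverse.eval 1 = P.eval 1 := by
        let _ : Invertible (1 : F) := invertibleOne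
        simpa using eval₂_reverse_mul_pow (RingHom.id F) 1 P
      simp only [dualPoly, Polynomial.map_id, eval_mul, eval_C, RingHom.id_apply, h1, hrev] at h
      have h2 : (2 : F) * P.eval 1 = 0 := by
        rw [inv_neg, inv_one] at h
        linear_combination -h
      exact (mul_eq_zero.1 h2).resolve_left hchar
    have hdeg := natDegree_eq_of_degree_eq_some (degree_eq_one_of_irreducible_of_root hirr heval)
    rw [hdeg] at heven
    exact absurd heven (by decide)

theorem stmt16 (F : Type*) [Field F] (hchar : (2 : F) ≠ 0)
    (σ : F →+* F) (hσinv : ∀ a, σ (σ a) = a)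
    (P : Polynomial F) (hirr : Irreducible P) (hns : P.coeff 0 ≠ 0)
    (hself : dualPoly σ P = P)
    -- the involution f(κ)° := f̄(κ⁻¹) on F(κ) = F[x]/(P)
    (τ : AdjoinRoot P ≃+* AdjoinRoot P)
    (hτF : ∀ a : F, τ (algebraMap F (AdjoinRoot P) a) = algebraMap F (AdjoinRoot P) (σ a))
    (hτκ : τ (AdjoinRoot.root P) * AdjoinRoot.root P = 1)
    (hτinv : ∀ z, τ (τ z) = z) :
    ∀ z : AdjoinRoot P, τ z = z →
      ∃! a : ℕ → F,
        (∀ i : ℕ, P.natDegree / 2 < i → a i = 0) ∧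
        a 0 = σ (a 0) ∧
        (Even P.natDegree →
          ((σ = RingHom.id F → a (P.natDegree / 2) = 0) ∧
           (σ ≠ RingHom.id F →
             ((P.coeff 0 ≠ 1 → σ (a (P.natDegree / 2)) = a (P.natDegree / 2)) ∧
              (P.coeff 0 = 1 → σ (a (P.natDegree / 2)) = -a (P.natDegree / 2)))))) ∧
        z = algebraMap F (AdjoinRoot P) (a 0) +
          ∑ i ∈ Finset.Icc 1 (P.natDegree / 2),
            (algebraMap F (AdjoinRoot P) (a i) * (AdjoinRoot.root P) ^ i +
             algebraMap F (AdjoinRoot P) (σ (a i)) * (τ (AdjoinRoot.root P)) ^ i) := by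
  intro z hz
  have hP := monic_of_dualPoly_eq hns hself
  have hpos : P.natDegree ≠ 0 := hirr.natDegree_pos.ne'
  have hunit : IsUnit (AdjoinRoot.root P) := IsUnit.of_mul_eq_one_right _ hτκ
  have hc0 : P.coeff 0 * σ (P.coeff 0) = 1 := by
    have h := map_coeff_of_dualPoly_eq hns hself (Nat.zero_le _)
    rw [Nat.sub_zero, hP.coeff_natDegree, map_one] at h
    rw [mul_comm, ← h]
  have hid : σ = RingHom.id F → Even P.natDegree → P.coeff 0 = 1 := by
    rintro rfl heven
    exact coeff_zero_eq_one_of_even hchar hirr hns hself heven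
  set r := P.natDegree / 2 with hr
  obtain ⟨Q, hQdeg, hQsymm, hQz⟩ := exists_symm_representative hchar hσinv hP hirr.ne_one hτF hτκ hz
    (r := r) (by omega)
  -- adjusting the representative so that its leading coefficient meets the normalization
  obtain ⟨Q', hQ'deg, hQ'symm, hQ'z, hQ'top⟩ : ∃ Q' : F[X], Q'.natDegree ≤ 2 * r ∧
      (∀ j ≤ 2 * r, σ (Q'.coeff (2 * r - j)) = Q'.coeff j) ∧
      aeval (AdjoinRoot.root P) Q' = AdjoinRoot.root P ^ r * z ∧
      (Even P.natDegree → ((σ = RingHom.id F → Q'.coeff (2 * r) = 0) ∧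
        (σ ≠ RingHom.id F →
          ((P.coeff 0 ≠ 1 → σ (Q'.coeff (2 * r)) = Q'.coeff (2 * r)) ∧
            (P.coeff 0 = 1 → σ (Q'.coeff (2 * r)) = -Q'.coeff (2 * r)))))) := by
    by_cases heven : Even P.natDegree
    swap
    · exact ⟨Q, hQdeg, hQsymm, hQz, fun h => absurd h heven⟩
    have hn : P.natDegree = 2 * r := by
      obtain ⟨m, hm⟩ := heven
      omega
    obtain ⟨t, ht, htop⟩ : ∃ t : F, σ t = t * P.coeff 0 ∧
        ((σ = RingHom.id F → Q.coeff (2 * r) - t = 0) ∧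
        (σ ≠ RingHom.id F →
          ((P.coeff 0 ≠ 1 → σ (Q.coeff (2 * r) - t) = Q.coeff (2 * r) - t) ∧
            (P.coeff 0 = 1 → σ (Q.coeff (2 * r) - t) = -(Q.coeff (2 * r) - t))))) := by
      set q := Q.coeff (2 * r)
      by_cases h1 : P.coeff 0 = 1
      · refine ⟨(q + σ q) / 2, ?_, ?_, fun _ => ⟨fun h => absurd h1 h, fun _ => ?_⟩⟩
        · rw [h1, map_div₀, map_add, hσinv, map_ofNat, mul_one, add_comm]
        · rintro rfl
          rw [RingHom.id_apply]
          field_simp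
          ring
        · rw [map_sub, map_div₀, map_add, hσinv, map_ofNat]
          field_simp
          ring
      · have hsub : P.coeff 0 - 1 ≠ 0 := sub_ne_zero.2 h1
        have hsub' : σ (P.coeff 0) - 1 ≠ 0 := by
          rw [← map_one σ, ← map_sub]
          exact (map_ne_zero σ).2 hsub
        have ht : σ ((σ q - q) / (P.coeff 0 - 1)) = (σ q - q) / (P.coeff 0 - 1) * P.coeff 0 := by
          rw [map_div₀, map_sub, map_sub, hσinv, map_one, div_mul_eq_mul_div,
            div_eq_div_iff hsub' hsub]
          linear_combination (q - σ q) * hc0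
        refine ⟨(σ q - q) / (P.coeff 0 - 1), ht, fun h => absurd (hid h heven) h1,
          fun _ => ⟨fun _ => ?_, fun h => absurd h h1⟩⟩
        rw [map_sub, ht]
        field_simp
        ring
    refine ⟨Q - C t * P, ?_, ?_, ?_, ?_⟩
    · exact (natDegree_sub_le_of_le hQdeg ((natDegree_C_mul_le _ _).trans hn.le)).trans
        (max_self _).le
    · intro j hj
      have h := map_coeff_of_dualPoly_eq hns hself (hj.trans hn.ge)
      rw [hn] at h
      rw [coeff_sub, coeff_sub, coeff_C_mul, coeff_C_mul, map_sub, map_mul, hQsymm j hj, h, ht]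
      linear_combination (-t * P.coeff j) * hc0
    · rw [map_sub, map_mul, hQz, AdjoinRoot.aeval_eq P, AdjoinRoot.mk_self, mul_zero, sub_zero]
    · intro _
      rw [coeff_sub, coeff_C_mul, ← hn, hP.coeff_natDegree, mul_one, hn]
      exact htop
  refine existsUnique_of_exists_of_unique
    ⟨fun i => if i ≤ r then Q'.coeff (r + i) else 0, ?_, ?_, ?_, ?_⟩ ?_
  · intro i hi
    exact if_neg (by omega)
  · have h := hQ'symm r (by omega)
    rw [show 2 * r - r = r by omega] at h
    simp [h]
  · simpa only [le_refl, if_true, ← two_mul] using hQ'top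
  · refine (hunit.pow r).mul_left_cancel ?_
    rw [← aeval_symmPoly σ (fun i => if i ≤ r then Q'.coeff (r + i) else 0) hτκ, ← hQ'z]
    congr 1
    refine (eq_symmPoly hQ'deg hQ'symm).trans ?_
    ext j
    rw [coeff_symmPoly, coeff_symmPoly]
    split_ifs <;> first | rfl | omega
  · rintro a b ⟨ha, ha0, hatop, haz⟩ ⟨hb, hb0, hbtop, hbz⟩
    have hzero : aeval (AdjoinRoot.root P) (symmPoly σ (fun i => a i - b i) r) = 0 := by
      have hsub : symmPoly σ (fun i => a i - b i) r = symmPoly σ a r - symmPoly σ b r := by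
        ext j
        simp only [coeff_sub, coeff_symmPoly, map_sub]
        split_ifs <;> simp
      rw [hsub, map_sub, aeval_symmPoly σ _ hτκ, aeval_symmPoly σ _ hτκ, ← haz, ← hbz, sub_self]
    have hlead : Even P.natDegree → P.natDegree ≠ 0 →
        σ (a r - b r) = (a r - b r) * P.coeff 0 → a r - b r = 0 := by
      intro heven _ ht
      obtain ⟨ha1, ha2⟩ := hatop heven
      obtain ⟨hb1, hb2⟩ := hbtop heven
      by_cases hσ : σ = RingHom.id F
      · rw [ha1 hσ, hb1 hσ, sub_self]
      by_cases h1 : P.coeff 0 = 1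
      · rw [map_sub, (ha2 hσ).2 h1, (hb2 hσ).2 h1, h1] at ht
        have h2 : (2 : F) * (a r - b r) = 0 := by linear_combination -ht
        exact (mul_eq_zero.1 h2).resolve_left hchar
      · rw [map_sub, (ha2 hσ).1 h1, (hb2 hσ).1 h1] at ht
        have h2 : (P.coeff 0 - 1) * (a r - b r) = 0 := by linear_combination -ht
        exact (mul_eq_zero.1 h2).resolve_left (sub_ne_zero.2 h1)
    ext i
    by_cases hi : i ≤ r
    · exact sub_eq_zero.1 (eq_zero_of_aeval_symmPoly_eq_zero (d := fun i => a i - b i)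
        hP hzero hlead hpos hi)
    · rw [ha i (by omega), hb i (by omega)]

end Stmt16
end
end Can
end

section
/- Let F be a field of characteristic not 2 with involution a ↦ ā (possibly the identity), and let Φ be an n×n nonsingular Frobenius block over F. A nonsingular matrix M over F with M = M*Φ exists if and only if p_Φ(x) = p_Φ^∨(x) and, in the case that the involution on F is the identity, additionally p_Φ(x) ≠ x + (−1)^{n+1}. Moreover, when these conditions hold, one such matrix M is the n×n Toeplitz matrix [a_{i−j}] whose vector of entries (a_{1−n}, a_{2−n}, …, a_{n−1}) is the χ_Φ-recurrent extension of the vector (a_{1−m},…,a_m) = (a, 0, …, 0, ā) of length 2m (2m = n if n is even, 2m = n + 1 if n is odd), where a := 1 if n is even, except when p_Φ(x) = x + c with c^{n−1} = −1; a := χ_Φ(−1) if n is odd and p_Φ(x) ≠ x + 1; and a := e − ē for any fixed e ∈ F with ē ≠ e otherwise. -/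
open Polynomial Matrix

namespace Can

noncomputable section

variable {F : Type*} [Field F]

section CompanionMatrix

variable {χ : F[X]}

theorem companion_pow_apply_zero (hn : 0 < χ.natDegree) {k : ℕ} (hk : k < χ.natDegree)
    (i : Fin χ.natDegree) :
    (companion F χ ^ k) i ⟨0, hn⟩ = if (i : ℕ) = k then 1 else 0 := by
  induction k generalizing i with
  | zero => simp [Matrix.one_apply, Fin.ext_iff]
  | succ k ih =>
    rw [pow_succ', Matrix.mul_apply, Finset.sum_eq_single ⟨k, by omega⟩]
    · rw [ih (by omega)]
      simp only [companion, Matrix.of_apply, if_true, mul_one]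
      rw [if_neg (show ¬ k + 1 = χ.natDegree by omega)]
    · intro j _ hj
      rw [ih (by omega), if_neg (fun h => hj (Fin.ext h)), mul_zero]
    · simp

theorem aeval_companion_apply_zero (hn : 0 < χ.natDegree) {f : F[X]}
    (hf : f.natDegree < χ.natDegree) (i : Fin χ.natDegree) :
    (aeval (companion F χ) f) i ⟨0, hn⟩ = f.coeff i := by
  rw [aeval_eq_sum_range' hf, Matrix.sum_apply, Finset.sum_eq_single (i : ℕ)]
  · simp [companion_pow_apply_zero hn i.2]
  · intro k hk hki
    simp [companion_pow_apply_zero hn (Finset.mem_range.1 hk), hki.symm]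
  · simp

theorem mul_eq_zero_of_mul_aeval_companion_col_eq_zero (hn : 0 < χ.natDegree)
    {A : Mat F χ.natDegree} {f : F[X]}
    (h : ∀ k : ℕ, (A * companion F χ ^ k * aeval (companion F χ) f).col ⟨0, hn⟩ = 0) :
    A * aeval (companion F χ) f = 0 := by
  ext i j
  have hcol : (A * companion F χ ^ (j : ℕ) * aeval (companion F χ) f) i ⟨0, hn⟩ = 0 :=
    congrFun (h j) i
  have hcomm : companion F χ ^ (j : ℕ) * aeval (companion F χ) f =
      aeval (companion F χ) f * companion F χ ^ (j : ℕ) := by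
    have : companion F χ ^ (j : ℕ) = aeval (companion F χ) (X ^ (j : ℕ) : F[X]) := by simp
    rw [this, ← map_mul, ← map_mul, mul_comm]
  rw [mul_assoc, hcomm, ← mul_assoc, Matrix.mul_apply, Finset.sum_eq_single j] at hcol
  · simpa [companion_pow_apply_zero hn j.2] using hcol
  · intro k _ hk
    rw [companion_pow_apply_zero hn j.2, if_neg (fun h => hk (Fin.ext h)), mul_zero]
  · simp

theorem aeval_companion_self (hχ : χ.Monic) (hn : 0 < χ.natDegree) :
    aeval (companion F χ) χ = 0 := by
  have key : ∀ i, (aeval (companion F χ) χ) i ⟨0, hn⟩ = 0 := by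
    intro i
    have hsucc : (companion F χ ^ χ.natDegree) i ⟨0, hn⟩ = - χ.coeff i := by
      obtain ⟨k, hk⟩ : ∃ k, χ.natDegree = k + 1 := ⟨χ.natDegree - 1, by omega⟩
      have : companion F χ ^ χ.natDegree = companion F χ * companion F χ ^ k := by
        rw [← pow_succ']; congr
      rw [this, Matrix.mul_apply, Finset.sum_eq_single ⟨k, by omega⟩]
      · rw [companion_pow_apply_zero hn (by omega)]
        simp only [companion, Matrix.of_apply, if_true, mul_one]
        rw [if_neg (by omega), if_pos hk.symm]
      · intro j _ hj
        rw [companion_pow_apply_zero hn (by omega), if_neg (fun h => hj (Fin.ext h)), mul_zero]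
      · simp
    rw [aeval_eq_sum_range, Finset.sum_range_succ, Matrix.add_apply, Matrix.sum_apply,
      Finset.sum_eq_single (i : ℕ)]
    · simp [companion_pow_apply_zero hn i.2, hsucc, hχ.coeff_natDegree]
    · intro k hk hki
      simp [companion_pow_apply_zero hn (Finset.mem_range.1 hk), hki.symm]
    · simp
  have hall := mul_eq_zero_of_mul_aeval_companion_col_eq_zero (A := 1) (f := χ) hn (by
    intro k
    ext i
    simp only [Matrix.col_apply, one_mul, Matrix.mul_apply, key, mul_zero, Finset.sum_const_zero,
      Pi.zero_apply])
  simpa using hall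

theorem aeval_companion_eq_zero_iff (hχ : χ.Monic) (hn : 0 < χ.natDegree) {f : F[X]} :
    aeval (companion F χ) f = 0 ↔ χ ∣ f := by
  constructor
  · intro h
    rw [← modByMonic_eq_zero_iff_dvd hχ]
    have hmod : aeval (companion F χ) (f %ₘ χ) = 0 := by
      have := modByMonic_add_div f χ
      rw [← this, map_add, map_mul, aeval_companion_self hχ hn, zero_mul, add_zero] at h
      exact h
    have hlt : (f %ₘ χ).natDegree < χ.natDegree :=
      natDegree_modByMonic_lt f hχ (fun h1 => by simp [h1] at hn)
    ext k
    by_cases hk : k < χ.natDegree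
    · rw [← aeval_companion_apply_zero hn hlt ⟨k, hk⟩, hmod]; simp
    · rw [coeff_eq_zero_of_natDegree_lt (by omega), coeff_zero]
  · rintro ⟨g, rfl⟩
    rw [map_mul, aeval_companion_self hχ hn, zero_mul]

theorem isUnit_companion (hχ : χ.Monic) (hn : 0 < χ.natDegree) (h0 : χ.coeff 0 ≠ 0) :
    IsUnit (companion F χ) := by
  have h : aeval (companion F χ) (divX χ * X + C (χ.coeff 0)) = 0 := by
    rw [divX_mul_X_add, aeval_companion_self hχ hn]
  rw [map_add, map_mul, aeval_X, aeval_C, Algebra.algebraMap_eq_smul_one] at h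
  refine IsUnit.of_mul_eq_one_right
    (-(χ.coeff 0)⁻¹ • aeval (companion F χ) (divX χ)) ?_
  rw [smul_mul_assoc, eq_neg_of_add_eq_zero_left h, smul_neg, smul_smul, neg_mul, neg_smul,
    neg_neg, inv_mul_cancel₀ h0, one_smul]

end CompanionMatrix

section DualPolynomial

variable (σ : F →+* F)

theorem reverse_pow (p : F[X]) (l : ℕ) : (p ^ l).reverse = p.reverse ^ l := by
  induction l with
  | zero => simp [← C_1, -map_one]
  | succ l ih => rw [pow_succ, reverse_mul_of_domain, ih, pow_succ]

theorem dualPoly_pow (p : F[X]) (l : ℕ) : dualPoly σ (p ^ l) = dualPoly σ p ^ l := by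
  have h0 : (p ^ l).coeff 0 = p.coeff 0 ^ l := by
    simp [coeff_zero_eq_eval_zero]
  rw [dualPoly, dualPoly, h0, Polynomial.map_pow, reverse_pow, mul_pow, ← C_pow, map_pow, inv_pow]

variable {σ}

theorem map_coeff_of_dualPoly_eq_self {χ : F[X]} (h0 : χ.coeff 0 ≠ 0) (hd : dualPoly σ χ = χ)
    {k : ℕ} (hk : k ≤ χ.natDegree) :
    σ (χ.coeff k) = σ (χ.coeff 0) * χ.coeff (χ.natDegree - k) := by
  have h := congrArg (fun f : F[X] => f.coeff (χ.natDegree - k)) hd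
  have h0' : σ (χ.coeff 0) ≠ 0 := by simpa using h0
  simp only [dualPoly, coeff_C_mul, coeff_reverse, natDegree_map,
    revAt_le (Nat.sub_le χ.natDegree k), coeff_map, Nat.sub_sub_self hk] at h
  rw [← h, mul_inv_cancel_left₀ h0']

theorem dualPoly_eq_self_of_dvd {p : F[X]} (hmon : p.Monic) (h0 : p.coeff 0 ≠ 0)
    (h : p ∣ (p.map σ).reverse) : dualPoly σ p = p := by
  obtain ⟨g, hg⟩ := h
  have hσ0 : σ (p.coeff 0) ≠ 0 := by simpa using h0
  have hne : (p.map σ).reverse ≠ 0 := by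
    rw [Ne, reverse_eq_zero, Polynomial.map_eq_zero]; exact hmon.ne_zero
  have hg0 : g ≠ 0 := by rintro rfl; simp [hg] at hne
  have hdeg : g.natDegree = 0 := by
    have h1 := reverse_natDegree_le (p.map σ)
    rw [hg, natDegree_mul hmon.ne_zero hg0, natDegree_map] at h1
    omega
  obtain ⟨c, rfl⟩ : ∃ c, g = C c := ⟨_, eq_C_of_natDegree_eq_zero hdeg⟩
  have hc : c = σ (p.coeff 0) := by
    have h1 := congrArg (fun f : F[X] => f.coeff p.natDegree) hg
    simpa [coeff_reverse, hmon.coeff_natDegree] using h1.symm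
  rw [dualPoly, hg, hc, mul_comm p, ← mul_assoc, ← C_mul, inv_mul_cancel₀ hσ0, C_1, one_mul]

end DualPolynomial

section Necessity

variable {σ : F →+* F}

theorem ctr_mul {m n k : ℕ} (A : Matrix (Fin m) (Fin n) F) (B : Matrix (Fin n) (Fin k) F) :
    ctr σ (A * B) = ctr σ B * ctr σ A := by
  rw [ctr, ctr, ctr, Matrix.map_mul, Matrix.transpose_mul]

theorem ctr_ctr (hσ : ∀ a, σ (σ a) = a) {m n : ℕ} (A : Matrix (Fin m) (Fin n) F) :
    ctr σ (ctr σ A) = A := by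
  ext i j
  simp [ctr, hσ]

theorem ctr_pow {n : ℕ} (A : Mat F n) (k : ℕ) : ctr σ (A ^ k) = ctr σ A ^ k := by
  induction k with
  | zero => ext i j; simp [ctr, Matrix.one_apply, eq_comm]
  | succ k ih => rw [pow_succ, ctr_mul, ih, pow_succ']

theorem eq_ctr_mul_mul_of_eq_ctr_mul (hσ : ∀ a, σ (σ a) = a) {n : ℕ} {M A : Mat F n}
    (h : M = ctr σ M * A) : M = ctr σ A * M * A := by
  have h1 : ctr σ M = ctr σ A * M := by
    conv_lhs => rw [h, ctr_mul, ctr_ctr hσ]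
  rw [← h1]; exact h

theorem eq_ctr_pow_mul_mul_pow {n : ℕ} {M A : Mat F n} (h : M = ctr σ A * M * A) (k : ℕ) :
    M = ctr σ A ^ k * M * A ^ k := by
  induction k with
  | zero => simp
  | succ k ih =>
    calc M = ctr σ A ^ k * (ctr σ A * M * A) * A ^ k := by rw [← h]; exact ih
    _ = _ := by rw [pow_succ (ctr σ A), pow_succ' A]; simp only [mul_assoc]

theorem aeval_reverse_eq_zero {n : ℕ} {M A : Mat F n} (hM : IsUnit M)
    (h : M = ctr σ A * M * A) {f : F[X]} (hf : aeval A f = 0) :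
    aeval A (f.map σ).reverse = 0 := by
  have hstar : ∑ k ∈ Finset.range (f.natDegree + 1), σ (f.coeff k) • ctr σ A ^ k = 0 := by
    have h1 : ctr σ (aeval A f) = 0 := by rw [hf]; ext i j; simp [ctr]
    rw [← h1, aeval_eq_sum_range]
    ext i j
    simp only [← ctr_pow]
    simp [ctr, Matrix.sum_apply]
  have hdeg : (f.map σ).reverse.natDegree < f.natDegree + 1 := by
    have := reverse_natDegree_le (f.map σ)
    rw [natDegree_map] at this
    omega
  refine (hM.mul_right_eq_zero).1 ?_
  rw [aeval_eq_sum_range' hdeg, ← Finset.sum_range_reflect, Finset.mul_sum]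
  calc _ = ∑ k ∈ Finset.range (f.natDegree + 1),
        (σ (f.coeff k) • ctr σ A ^ k) * (M * A ^ f.natDegree) := by
        refine Finset.sum_congr rfl fun k hk => ?_
        have hk' : k ≤ f.natDegree := by simpa [Nat.lt_succ_iff] using hk
        have hr : f.natDegree + 1 - 1 - k = f.natDegree - k := by omega
        rw [hr, coeff_reverse, natDegree_map, revAt_le (Nat.sub_le _ _), Nat.sub_sub_self hk',
          coeff_map, mul_smul_comm, smul_mul_assoc]
        congr 1
        conv_lhs => rw [eq_ctr_pow_mul_mul_pow h k]
        rw [mul_assoc, mul_assoc, ← pow_add, Nat.add_sub_cancel' hk']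
    _ = 0 := by rw [← Finset.sum_mul, hstar, zero_mul]

theorem dualPoly_eq_self_of_eq_ctr_mul (hσ : ∀ a, σ (σ a) = a) {p : F[X]} {l : ℕ}
    (hmon : p.Monic) (hirr : Irreducible p) (hl : 0 < l) (h0 : p.coeff 0 ≠ 0)
    {M : Mat F (p ^ l).natDegree} (hM : IsUnit M.det) (h : M = ctr σ M * companion F (p ^ l)) :
    dualPoly σ p = p := by
  have hn : 0 < (p ^ l).natDegree := by
    rw [natDegree_pow]; exact Nat.mul_pos hl hirr.natDegree_pos
  have h1 := aeval_reverse_eq_zero ((Matrix.isUnit_iff_isUnit_det M).2 hM)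
    (eq_ctr_mul_mul_of_eq_ctr_mul hσ h) (aeval_companion_self (hmon.pow l) hn)
  rw [aeval_companion_eq_zero_iff (hmon.pow l) hn, Polynomial.map_pow, reverse_pow] at h1
  exact dualPoly_eq_self_of_dvd hmon h0
    (hirr.prime.dvd_of_dvd_pow ((dvd_pow_self p hl.ne').trans h1))

end Necessity

section Cosquare

/-- If `M = Mᵀ A` and `A + r` is nilpotent of index `k + 1` with `r = (-1)ᵏ`, then
`M (A + r)ᵏ` is skew-symmetric. -/
theorem transpose_mul_pow_eq_neg {n k : ℕ} {M A : Mat F n} {r : F} (hr : r = (-1) ^ k)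
    (h : M = Mᵀ * A) (hN : (A + r • 1) ^ (k + 1) = 0) :
    (M * (A + r • 1) ^ k)ᵀ = -(M * (A + r • 1) ^ k) := by
  have hr2 : r * r = 1 := by rw [hr, ← mul_pow]; simp
  have hT : Mᵀ = Aᵀ * M := by
    conv_lhs => rw [h, Matrix.transpose_mul, Matrix.transpose_transpose]
  have hM : M = Aᵀ * M * A := by rw [← hT]; exact h
  have hAN : A * (A + r • 1) ^ k = -r • (A + r • 1) ^ k := by
    rw [pow_succ', add_mul, smul_mul_assoc, one_mul] at hN
    rw [eq_neg_of_add_eq_zero_left hN, neg_smul]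
  have hNA : (Aᵀ + r • 1) ^ k * Aᵀ = -r • (Aᵀ + r • 1) ^ k := by
    have := congrArg Matrix.transpose hAN
    simpa [Matrix.transpose_pow] using this
  have h1 : ∀ j : ℕ, (Aᵀ + r • 1) ^ j * M * A ^ j = r ^ j • (M * (A + r • 1) ^ j) := by
    intro j
    induction j with
    | zero => simp
    | succ j ih =>
      have hstep : (Aᵀ + r • 1) * M * A = r • (M * (A + r • 1)) := by
        rw [add_mul, add_mul, ← hM, mul_add, smul_add, mul_smul_comm, smul_smul, hr2]
        simp [add_comm]
      have hcomm : (A + r • 1) * A ^ j = A ^ j * (A + r • 1) := by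
        rw [add_mul, mul_add, ← pow_succ, ← pow_succ']; simp
      calc (Aᵀ + r • 1) ^ (j + 1) * M * A ^ (j + 1)
          = (Aᵀ + r • 1) ^ j * ((Aᵀ + r • 1) * M * A) * A ^ j := by
            rw [pow_succ, pow_succ']; simp only [mul_assoc]
        _ = r • ((Aᵀ + r • 1) ^ j * M * A ^ j * (A + r • 1)) := by
            rw [hstep, mul_smul_comm, smul_mul_assoc, mul_assoc, mul_assoc, hcomm]
            simp only [mul_assoc]
        _ = _ := by
            rw [ih, smul_mul_assoc, smul_smul, mul_assoc, ← pow_succ, ← pow_succ']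
  have h2 : ∀ j : ℕ, (Aᵀ + r • 1) ^ k * M = (-r) ^ j • ((Aᵀ + r • 1) ^ k * M * A ^ j) := by
    intro j
    induction j with
    | zero => simp
    | succ j ih =>
      have hstep : (Aᵀ + r • 1) ^ k * M = -r • ((Aᵀ + r • 1) ^ k * M * A) := by
        conv_lhs => rw [hM, ← mul_assoc, ← mul_assoc, hNA]
        simp only [smul_mul_assoc]
      conv_lhs => rw [hstep, ih]
      rw [smul_mul_assoc, smul_smul, mul_assoc _ (A ^ j), ← pow_succ, ← pow_succ']
  have h3 : (Aᵀ + r • 1) ^ k * M = r • (M * (A + r • 1) ^ k) := by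
    rw [h2 k, h1 k, smul_smul, ← mul_pow, neg_mul, hr2, hr]
  have h4 : M * (A + r • 1) ^ k = -r • (Mᵀ * (A + r • 1) ^ k) := by
    conv_lhs => rw [h, mul_assoc, hAN, mul_smul_comm]
  have h5 := congrArg Matrix.transpose h3
  simp only [Matrix.transpose_mul, Matrix.transpose_pow, Matrix.transpose_add,
    Matrix.transpose_transpose, Matrix.transpose_smul, Matrix.transpose_one] at h5 ⊢
  rw [h4, h5, smul_smul, neg_mul, hr2]
  simp

theorem det_eq_zero_of_eq_transpose_mul_companion (hchar : (2 : F) ≠ 0) {χ : F[X]}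
    (hχ : χ.Monic) (hn : 0 < χ.natDegree)
    (hX : χ = (X + C ((-1) ^ (χ.natDegree + 1))) ^ χ.natDegree) {M : Mat F χ.natDegree}
    (h : M = Mᵀ * companion F χ) : M.det = 0 := by
  obtain ⟨k, hk⟩ : ∃ k, χ.natDegree = k + 1 := ⟨χ.natDegree - 1, by omega⟩
  set A := companion F χ with hA
  set r : F := (-1) ^ k with hr
  have hX' : χ = (X + C r) ^ (k + 1) := by
    have hsign : (-1 : F) ^ (χ.natDegree + 1) = r := by rw [hk, hr]; ring
    rwa [hsign, hk] at hX
  have haeval : ∀ j : ℕ, aeval A ((X + C r) ^ j) = (A + r • 1) ^ j := by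
    intro j; simp [Algebra.algebraMap_eq_smul_one]
  have hN : (A + r • 1) ^ (k + 1) = 0 := by
    rw [← haeval, ← hX', hA, aeval_companion_self hχ hn]
  have hskew := transpose_mul_pow_eq_neg hr h hN
  set T := M * (A + r • 1) ^ k with hT
  have hTA : ∀ j : ℕ, T * A ^ j = (-r) ^ j • T := by
    have h1 : T * A = -r • T := by
      have hN' := hN
      rw [pow_succ, mul_add, mul_smul_comm, mul_one] at hN'
      rw [hT, mul_assoc, eq_neg_of_add_eq_zero_left hN', neg_smul, mul_neg, mul_smul_comm]
    intro j
    induction j with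
    | zero => simp
    | succ j ih => rw [pow_succ, ← mul_assoc, ih, smul_mul_assoc, h1, smul_smul, pow_succ]
  have hcol : ∀ i j, T i j = (-r) ^ (j : ℕ) * T i ⟨0, hn⟩ := by
    intro i j
    have := congrFun (congrFun (hTA j) i) ⟨0, hn⟩
    rw [Matrix.mul_apply, Finset.sum_eq_single j] at this
    · simpa [hA, companion_pow_apply_zero hn j.2] using this
    · intro b _ hb
      rw [hA, companion_pow_apply_zero hn j.2, if_neg (fun h => hb (Fin.ext h)), mul_zero]
    · simp
  have hsk : ∀ i j, T i j = - T j i := by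
    intro i j
    have := congrFun (congrFun hskew j) i
    simpa using this
  have h00 : T ⟨0, hn⟩ ⟨0, hn⟩ = 0 := by
    have h1 := hsk ⟨0, hn⟩ ⟨0, hn⟩
    have h2 : (2 : F) * T ⟨0, hn⟩ ⟨0, hn⟩ = 0 := by linear_combination h1
    exact (mul_eq_zero.1 h2).resolve_left hchar
  have hT0 : T = 0 := by
    ext i j
    rw [hcol i j, hsk i, hcol ⟨0, hn⟩ i, h00]
    simp
  by_contra hdet
  have hunit : IsUnit M := (Matrix.isUnit_iff_isUnit_det M).2 (isUnit_iff_ne_zero.2 hdet)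
  have hzero : aeval A ((X + C r) ^ k) = 0 := by
    rw [haeval]; exact hunit.mul_right_eq_zero.1 hT0
  rw [hA, aeval_companion_eq_zero_iff hχ hn] at hzero
  have hdeg := natDegree_le_of_dvd hzero ((monic_X_add_C r).pow k).ne_zero
  rw [(monic_X_add_C r).natDegree_pow, natDegree_X_add_C] at hdeg
  omega

end Cosquare

section Recurrence

variable {σ : F →+* F} {χ : F[X]}

theorem eq_zero_of_recurrent (hχ : χ.Monic) (h0 : χ.coeff 0 ≠ 0) {d : ℤ → F} {A B L : ℤ}
    (hA : A ≤ L) (hB : L + χ.natDegree ≤ B + 1)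
    (hrec : ∀ t : ℤ, A ≤ t → t + χ.natDegree ≤ B →
      ∑ s ∈ Finset.range (χ.natDegree + 1), χ.coeff (χ.natDegree - s) * d (t + s) = 0)
    (hd : ∀ k, L ≤ k → k < L + χ.natDegree → d k = 0) {k : ℤ} (hAk : A ≤ k) (hkB : k ≤ B) :
    d k = 0 := by
  have key : ∀ r : ℕ, ∀ k : ℤ, L - r ≤ k → k < L + χ.natDegree + r → A ≤ k → k ≤ B → d k = 0 := by
    intro r
    induction r with
    | zero => intro k h1 h2 _ _; exact hd k (by simpa using h1) (by simpa using h2)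
    | succ r ih =>
      intro k h1 h2 h3 h4
      push_cast at h1 h2
      by_cases hl : k < L - r
      · have h := hrec k h3 (by omega)
        rw [Finset.sum_eq_single 0] at h
        · simpa [hχ.coeff_natDegree] using h
        · intro s hs hs0
          have hs' := Finset.mem_range.1 hs
          rw [ih (k + s) (by omega) (by omega) (by omega) (by omega), mul_zero]
        · simp
      by_cases hr : L + χ.natDegree + r ≤ k
      · have h := hrec (k - χ.natDegree) (by omega) (by omega)
        rw [Finset.sum_eq_single χ.natDegree] at h
        · simpa [h0] using h
        · intro s hs hs0
          have hs' := Finset.mem_range.1 hs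
          rw [ih _ (by omega) (by omega) (by omega) (by omega), mul_zero]
        · simp
      · exact ih k (by omega) (by omega) h3 h4
  exact key ((k - L).natAbs + 1) k (by omega) (by omega) hAk hkB

theorem map_eq_of_recurrent (hσ : ∀ a, σ (σ a) = a) (hχ : χ.Monic) (h0 : χ.coeff 0 ≠ 0)
    (hd : dualPoly σ χ = χ) {m : ℕ} (hm1 : χ.natDegree ≤ 2 * m) (hm2 : m < χ.natDegree) {a : ℤ → F}
    (hfrag : ∀ j : ℤ, 1 - (m : ℤ) ≤ j → j ≤ m → σ (a j) = a (1 - j))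
    (hrec : ∀ t : ℤ, 1 - (χ.natDegree : ℤ) ≤ t → t + χ.natDegree ≤ (χ.natDegree : ℤ) - 1 →
      ∑ s ∈ Finset.range (χ.natDegree + 1), χ.coeff (χ.natDegree - s) * a (t + s) = 0)
    {k : ℤ} (hk1 : 2 - (χ.natDegree : ℤ) ≤ k) (hk2 : k ≤ (χ.natDegree : ℤ) - 1) :
    σ (a k) = a (1 - k) := by
  have h := eq_zero_of_recurrent (d := fun k => a k - σ (a (1 - k))) (A := 2 - χ.natDegree)
    (B := χ.natDegree - 1) (L := 1 - m) (k := 1 - k) hχ h0 (by omega) (by omega) ?_ ?_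
    (by omega) (by omega)
  · have h' := sub_eq_zero.1 h
    rw [sub_sub_cancel] at h'
    exact h'.symm
  · intro t ht1 ht2
    simp only [mul_sub, Finset.sum_sub_distrib]
    rw [hrec t (by omega) (by omega), zero_sub, neg_eq_zero]
    have hdual := congrArg (fun x => χ.coeff 0 * σ x)
      (hrec (1 - t - χ.natDegree) (by omega) (by omega))
    simp only [map_sum, map_zero, mul_zero, Finset.mul_sum] at hdual
    rw [← hdual, ← Finset.sum_range_reflect]
    refine Finset.sum_congr rfl fun s hs => ?_
    have hs' : s ≤ χ.natDegree := by simpa [Nat.lt_succ_iff] using hs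
    have h1 : χ.natDegree + 1 - 1 - s = χ.natDegree - s := by omega
    have h2 : χ.coeff s = χ.coeff 0 * σ (χ.coeff (χ.natDegree - s)) := by
      conv_lhs => rw [← hσ (χ.coeff s), map_coeff_of_dualPoly_eq_self h0 hd hs', map_mul, hσ]
    rw [h1, Nat.sub_sub_self hs', map_mul, ← mul_assoc, ← h2]
    congr 3
    omega
  · intro j hj1 hj2
    have := hfrag (1 - j) (by omega) (by omega)
    rw [sub_sub_cancel] at this
    exact sub_eq_zero.2 this.symm

theorem toeplitz_eq_ctr_mul_companion (hχ : χ.Monic)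
    (h0 : χ.coeff 0 ≠ 0) (hd : dualPoly σ χ = χ) {a : ℤ → F}
    (hend : χ.natDegree = 1 → a 0 + χ.coeff 0 * σ (a 0) = 0)
    (hsymm : ∀ k : ℤ, 2 - (χ.natDegree : ℤ) ≤ k → k ≤ (χ.natDegree : ℤ) - 1 → σ (a k) = a (1 - k))
    (hrec : ∀ t : ℤ, 1 - (χ.natDegree : ℤ) ≤ t → t + χ.natDegree ≤ (χ.natDegree : ℤ) - 1 →
      ∑ s ∈ Finset.range (χ.natDegree + 1), χ.coeff (χ.natDegree - s) * a (t + s) = 0) :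
    (Matrix.of fun i j : Fin χ.natDegree => a ((i : ℤ) - (j : ℤ))) =
      ctr σ (Matrix.of fun i j : Fin χ.natDegree => a ((i : ℤ) - (j : ℤ))) * companion F χ := by
  ext i j
  have hi := i.2
  have hj := j.2
  rw [Matrix.mul_apply]
  simp only [ctr, companion, Matrix.of_apply, Matrix.transpose_apply, Matrix.map_apply]
  by_cases hlast : (j : ℕ) + 1 = χ.natDegree
  · have hterm : ∀ x : Fin χ.natDegree, σ (a ((x : ℤ) - (i : ℤ))) *
        (if (x : ℕ) = (j : ℕ) + 1 then 1 else if (j : ℕ) + 1 = χ.natDegree then -χ.coeff x else 0)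
        = -(σ (a ((x : ℤ) - (i : ℤ))) * χ.coeff x) := by
      intro x
      have hx := x.2
      rw [if_neg (by omega), if_pos hlast, mul_neg]
    rw [Finset.sum_congr rfl (fun x _ => hterm x), Finset.sum_neg_distrib,
      Fin.sum_univ_eq_sum_range (fun x => σ (a ((x : ℤ) - (i : ℤ))) * χ.coeff x), eq_neg_iff_add_eq_zero]
    by_cases hi' : (i : ℕ) + 1 = χ.natDegree
    · have hij : ((i : ℤ) - j) = 0 := by omega
      rw [hij]
      by_cases h1 : χ.natDegree = 1
      · have hsum : ∀ N : ℕ, N = 1 → ∑ x ∈ Finset.range N, σ (a ((x : ℤ) - i)) * χ.coeff x =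
            σ (a (0 - i)) * χ.coeff 0 := by
          rintro N rfl; simp
        have hi0 : (0 - (i : ℤ)) = 0 := by omega
        rw [hsum _ h1, hi0, mul_comm (σ (a 0))]
        exact hend h1
      have hσ0 : σ (χ.coeff 0) ≠ 0 := by simpa using h0
      have h := congrArg σ (hrec (1 - χ.natDegree) (by omega) (by omega))
      simp only [map_sum, map_zero, map_mul] at h
      have h' : σ (χ.coeff 0) *
          ∑ x ∈ Finset.range (χ.natDegree + 1), σ (a ((x : ℤ) - i)) * χ.coeff x = 0 := by
        rw [← h, Finset.mul_sum]
        refine Finset.sum_congr rfl fun x hx => ?_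
        have hx' : x ≤ χ.natDegree := by simpa [Nat.lt_succ_iff] using hx
        rw [map_coeff_of_dualPoly_eq_self h0 hd (Nat.sub_le _ x), Nat.sub_sub_self hx',
          mul_assoc, mul_comm (χ.coeff x)]
        congr 4
        omega
      have h'' := (mul_eq_zero.1 h').resolve_left hσ0
      have hi1 : ((χ.natDegree : ℤ) - i) = 1 := by omega
      rw [Finset.sum_range_succ, hi1, hsymm 1 (by omega) (by omega), hχ.coeff_natDegree, mul_one,
        add_comm] at h''
      simpa using h''
    · have h := hrec (i + 1 - χ.natDegree) (by omega) (by omega)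
      rw [← Finset.sum_range_reflect, Finset.sum_range_succ, add_comm] at h
      rw [← h]
      congr 1
      · simp [hχ.coeff_natDegree]
        congr 1; omega
      · refine Finset.sum_congr rfl fun x hx => ?_
        have hx' := Finset.mem_range.1 hx
        rw [hsymm _ (by omega) (by omega), mul_comm]
        congr 2 <;> omega
  · rw [Finset.sum_eq_single ⟨j + 1, by omega⟩]
    · simp only [if_true, mul_one]
      rw [hsymm _ (by push_cast; omega) (by push_cast; omega)]
      congr 1; push_cast; omega
    · intro x _ hx
      rw [if_neg (fun h => hx (Fin.ext h)), if_neg hlast, mul_zero]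
    · simp

end Recurrence

section Nonsingularity

variable {σ : F →+* F}

theorem exists_mul_aeval_companion_eq_zero {χ : F[X]} (hχ : χ.Monic) (hn : 0 < χ.natDegree)
    (h0 : χ.coeff 0 ≠ 0) {M : Mat F χ.natDegree}
    (h : M = ctr σ (companion F χ) * M * companion F χ) (hdet : M.det = 0) :
    ∃ f : F[X], ¬ χ ∣ f ∧ M * aeval (companion F χ) f = 0 := by
  obtain ⟨v, hv, hMv⟩ := Matrix.exists_mulVec_eq_zero_iff.2 hdet
  set f : F[X] := ∑ i : Fin χ.natDegree, monomial (i : ℕ) (v i) with hf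
  have hcoeff : ∀ i : Fin χ.natDegree, f.coeff i = v i := by
    intro i
    simp only [hf, finsetSum_coeff, coeff_monomial]
    rw [Finset.sum_eq_single i]
    · simp
    · intro b _ hb
      rw [if_neg (fun h => hb (Fin.ext h))]
    · simp
  have hdeg : f.natDegree < χ.natDegree := by
    have : f.natDegree ≤ χ.natDegree - 1 :=
      natDegree_sum_le_of_forall_le _ _ fun i _ =>
        (natDegree_monomial_le _).trans (by have := i.2; omega)
    omega
  have hf0 : f ≠ 0 := by
    intro hzero
    apply hv
    ext i
    rw [← hcoeff, hzero]; simp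
  refine ⟨f, fun hdvd => ?_, mul_eq_zero_of_mul_aeval_companion_col_eq_zero hn fun k => ?_⟩
  · have := natDegree_le_of_dvd hdvd hf0
    omega
  · have hunit : IsUnit (ctr σ (companion F χ) ^ k) := by
      obtain ⟨D, hD⟩ := (isUnit_companion hχ hn h0).exists_right_inv
      refine IsUnit.pow k (IsUnit.of_mul_eq_one_right (ctr σ D) ?_)
      rw [← ctr_mul, hD]
      ext i j; simp [ctr, Matrix.one_apply, eq_comm]
    have hcol : (M * aeval (companion F χ) f).col ⟨0, hn⟩ = 0 := by
      ext i
      have := congrFun hMv i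
      simpa [Matrix.mul_apply, Matrix.mulVec, dotProduct, aeval_companion_apply_zero hn hdeg,
        hcoeff] using this
    refine Matrix.mulVec_injective_of_isUnit hunit ?_
    rw [Matrix.mulVec_zero, ← hcol]
    conv_rhs => rw [eq_ctr_pow_mul_mul_pow h k]
    ext i
    simp only [mul_assoc]
    rw [Matrix.col_apply, Matrix.mul_apply]
    rfl

theorem mul_aeval_pow_pred_eq_zero {n : ℕ} {M A : Mat F n} {p : F[X]} {l : ℕ}
    (hirr : Irreducible p) (hA : aeval A (p ^ l) = 0) {f : F[X]} (hf : ¬ p ^ l ∣ f)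
    (h : M * aeval A f = 0) : M * aeval A (p ^ (l - 1)) = 0 := by
  classical
  obtain ⟨i, hi, hassoc⟩ :=
    (dvd_prime_pow hirr.prime l).1 (EuclideanDomain.gcd_dvd_right f (p ^ l))
  have hil : i ≠ l := by
    rintro rfl
    exact hf (hassoc.symm.dvd.trans (EuclideanDomain.gcd_dvd_left f _))
  obtain ⟨g, hg⟩ : EuclideanDomain.gcd f (p ^ l) ∣ p ^ (l - 1) :=
    hassoc.dvd.trans (pow_dvd_pow p (by omega))
  rw [hg, EuclideanDomain.gcd_eq_gcd_ab, map_mul, map_add, map_mul, map_mul, hA, zero_mul,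
    add_zero, ← mul_assoc, ← mul_assoc, h, zero_mul, zero_mul]

theorem toeplitz_det_ne_zero {p : F[X]} {l m : ℕ} (hmon : p.Monic) (hirr : Irreducible p)
    (hl : 0 < l) (h0 : p.coeff 0 ≠ 0) {a : ℤ → F} {M : Mat F (p ^ l).natDegree}
    (hMa : M = Matrix.of fun i j : Fin (p ^ l).natDegree => a ((i : ℤ) - (j : ℤ)))
    (h : M = ctr σ (companion F (p ^ l)) * M * companion F (p ^ l))
    (hm : 2 * m = (p ^ l).natDegree ∨ 2 * m = (p ^ l).natDegree + 1)
    (hfrag : ∀ j : ℤ, 1 - (m : ℤ) < j → j < m → a j = 0) (ha : a (1 - m) ≠ 0)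
    (hlin : 2 * m = (p ^ l).natDegree → p.natDegree = 1 →
      a (1 - m) + a m * p.coeff 0 ^ (l - 1) ≠ 0) : M.det ≠ 0 := by
  intro hdet
  have hd := hirr.natDegree_pos
  have hdegl : (p ^ l).natDegree = l * p.natDegree := natDegree_pow p l
  have hn : 0 < (p ^ l).natDegree := by rw [hdegl]; exact Nat.mul_pos hl hd
  have h0l : (p ^ l).coeff 0 ≠ 0 := by
    rw [coeff_zero_eq_eval_zero, eval_pow, ← coeff_zero_eq_eval_zero]
    exact pow_ne_zero l h0
  obtain ⟨f, hf, hMf⟩ := exists_mul_aeval_companion_eq_zero (hmon.pow l) hn h0l h hdet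
  have hker := mul_aeval_pow_pred_eq_zero hirr (aeval_companion_self (hmon.pow l) hn) hf hMf
  set g : F[X] := p ^ (l - 1) * X ^ (p.natDegree - 1) with hg
  have hMg : M * aeval (companion F (p ^ l)) g = 0 := by
    rw [hg, map_mul, ← mul_assoc, hker, zero_mul]
  have hgmon : g.Monic := (hmon.pow _).mul (monic_X_pow _)
  obtain ⟨k, hk⟩ : ∃ k, (p ^ l).natDegree = k + 1 := ⟨(p ^ l).natDegree - 1, by omega⟩
  have hgdeg : g.natDegree = k := by
    obtain ⟨l, rfl⟩ : ∃ l', l = l' + 1 := ⟨l - 1, by omega⟩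
    rw [hg, (hmon.pow _).natDegree_mul (monic_X_pow _), natDegree_pow, natDegree_X_pow]
    rw [hk, add_mul] at hdegl
    simp only [Nat.add_sub_cancel]
    omega
  have hrow := congrFun (congrFun hMg ⟨(p ^ l).natDegree - m, by omega⟩) ⟨0, hn⟩
  rw [Matrix.mul_apply] at hrow
  simp only [aeval_companion_apply_zero hn (show g.natDegree < (p ^ l).natDegree by omega)] at hrow
  rw [hMa] at hrow
  simp only [Matrix.of_apply, Matrix.zero_apply] at hrow
  rw [Fin.sum_univ_eq_sum_range (fun x : ℕ =>
    a (((((p ^ l).natDegree - m : ℕ)) : ℤ) - (x : ℤ)) * g.coeff x), hk, Finset.sum_range_succ,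
    ← hgdeg, hgmon.coeff_natDegree, hgdeg, mul_one,
    show ((k + 1 - m : ℕ) : ℤ) - k = 1 - m by omega] at hrow
  rcases hm with hm | hm
  · rw [Finset.sum_eq_single 0] at hrow
    · have hidx : ((k + 1 - m : ℕ) : ℤ) - (0 : ℕ) = m := by omega
      rw [hidx] at hrow
      by_cases hd1 : p.natDegree = 1
      · apply hlin hm hd1
        have hg0 : g.coeff 0 = p.coeff 0 ^ (l - 1) := by
          rw [hg, hd1]; simp [coeff_zero_eq_eval_zero]
        rw [← hg0, add_comm]; exact hrow
      · have hg0 : g.coeff 0 = 0 := by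
          rw [hg, coeff_zero_eq_eval_zero, eval_mul, eval_pow (n := p.natDegree - 1), eval_X,
            zero_pow (by omega), mul_zero]
        rw [hg0, mul_zero, zero_add] at hrow
        exact ha hrow
    · intro j hj hj0
      have hj' := Finset.mem_range.1 hj
      rw [hfrag _ (by omega) (by omega), zero_mul]
    · intro hk0
      exfalso
      rw [Finset.mem_range] at hk0
      omega
  · rw [Finset.sum_eq_zero, zero_add] at hrow
    · exact ha hrow
    · intro j hj
      have hj' := Finset.mem_range.1 hj
      rw [hfrag _ (by omega) (by omega), zero_mul]

end Nonsingularity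

section Existence

theorem exists_recurrent_extension {χ : F[X]} (hχ : χ.Monic) (hn : 0 < χ.natDegree)
    (h0 : χ.coeff 0 ≠ 0) (L : ℤ) (w : ℕ → F) :
    ∃ a : ℤ → F,
      (∀ t : ℤ, ∑ s ∈ Finset.range (χ.natDegree + 1),
        χ.coeff (χ.natDegree - s) * a (t + s) = 0) ∧
      ∀ j : ℕ, j < χ.natDegree → a (L + j) = w j := by
  obtain ⟨U, hU⟩ := isUnit_companion hχ hn h0
  refine ⟨fun k => ∑ i : Fin χ.natDegree, w (χ.natDegree - 1 - i) *
    ((U ^ (L + χ.natDegree - 1 - k) : (Mat F χ.natDegree)ˣ) : Mat F χ.natDegree) i ⟨0, hn⟩, ?_, ?_⟩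
  · intro t
    have hsum : ∑ s ∈ Finset.range (χ.natDegree + 1), χ.coeff (χ.natDegree - s) •
        ((U ^ (L + χ.natDegree - 1 - (t + s)) : (Mat F χ.natDegree)ˣ) : Mat F χ.natDegree) = 0 := by
      have hχ0 := aeval_companion_self hχ hn
      rw [aeval_eq_sum_range, ← Finset.sum_range_reflect, ← hU] at hχ0
      have := congrArg (fun A => ((U ^ (L - 1 - t) : (Mat F χ.natDegree)ˣ) : Mat F χ.natDegree) * A)
        hχ0
      simp only [mul_zero, Finset.mul_sum, mul_smul_comm] at this
      rw [← this]
      refine Finset.sum_congr rfl fun s hs => ?_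
      have hs' : s ≤ χ.natDegree := by simpa [Nat.lt_succ_iff] using hs
      have hidx : χ.natDegree + 1 - 1 - s = χ.natDegree - s := by omega
      rw [hidx, ← Units.val_pow_eq_pow_val, ← Units.val_mul, ← zpow_natCast, ← _root_.zpow_add]
      congr 3
      omega
    simp only [Finset.mul_sum]
    rw [Finset.sum_comm]
    refine Finset.sum_eq_zero fun i _ => ?_
    have hi := congrFun (congrFun hsum i) ⟨0, hn⟩
    simp only [Matrix.sum_apply, Matrix.smul_apply, smul_eq_mul, Matrix.zero_apply] at hi
    rw [← mul_zero (w (χ.natDegree - 1 - i)), ← hi, Finset.mul_sum]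
    refine Finset.sum_congr rfl fun s _ => ?_
    ring
  · intro j hj
    have hpow : L + χ.natDegree - 1 - (L + j) = ((χ.natDegree - 1 - j : ℕ) : ℤ) := by omega
    simp only [hpow, zpow_natCast, Units.val_pow_eq_pow_val, hU]
    rw [Finset.sum_eq_single ⟨χ.natDegree - 1 - j, by omega⟩]
    · rw [companion_pow_apply_zero hn (by omega), if_pos rfl, mul_one]
      congr 1
      simp only
      omega
    · intro b _ hb
      rw [companion_pow_apply_zero hn (by omega), if_neg (fun h => hb (Fin.ext h)), mul_zero]
    · simp

end Existence

section ToeplitzParameter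

variable {σ : F →+* F}

/-- The three alternatives for the leading entry of the Toeplitz matrix, for a polynomial `χ`
that is a power of `p`. -/
def IsToeplitzParameter (σ : F →+* F) (p χ : F[X]) (x : F) : Prop :=
  ((Even χ.natDegree ∧ ¬ ∃ c : F, p = X + C c ∧ c ^ (χ.natDegree - 1) = -1) ∧ x = 1) ∨
  ((Odd χ.natDegree ∧ p ≠ X + C 1) ∧ x = χ.eval (-1)) ∨
  (¬ (Even χ.natDegree ∧ ¬ ∃ c : F, p = X + C c ∧ c ^ (χ.natDegree - 1) = -1) ∧
    ¬ (Odd χ.natDegree ∧ p ≠ X + C 1) ∧ ∃ e : F, σ e ≠ e ∧ x = e - σ e)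

theorem eq_X_add_C_of_natDegree_eq_one {p : F[X]} (hmon : p.Monic) (h : p.natDegree = 1) :
    p = X + C (p.coeff 0) := by
  have := eq_X_add_C_of_natDegree_le_one h.le
  rwa [← h, hmon.coeff_natDegree, C_1, one_mul] at this

theorem map_eval_neg_one {χ : F[X]} (h0 : χ.coeff 0 ≠ 0) (hd : dualPoly σ χ = χ) :
    σ (χ.eval (-1)) = (-1) ^ χ.natDegree * (σ (χ.coeff 0) * χ.eval (-1)) := by
  rw [eval_eq_sum_range, map_sum, ← Finset.sum_range_reflect, Finset.mul_sum, Finset.mul_sum]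
  refine Finset.sum_congr rfl fun s hs => ?_
  have hs' : s ≤ χ.natDegree := by simpa [Nat.lt_succ_iff] using hs
  have hidx : χ.natDegree + 1 - 1 - s = χ.natDegree - s := by omega
  have hpow : (-1 : F) ^ χ.natDegree = (-1) ^ (χ.natDegree - s) * (-1) ^ s := by
    rw [← pow_add, Nat.sub_add_cancel hs']
  have hsq : (-1 : F) ^ s * (-1) ^ s = 1 := by rw [← mul_pow]; simp
  rw [hidx, map_mul, map_coeff_of_dualPoly_eq_self h0 hd (Nat.sub_le _ s), Nat.sub_sub_self hs',
    map_pow, map_neg, map_one, hpow]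
  linear_combination -(-1 : F) ^ (χ.natDegree - s) * σ (χ.coeff 0) * χ.coeff s * hsq

theorem coeff_zero_mul_map_coeff_zero {χ : F[X]} (hχ : χ.Monic) (h0 : χ.coeff 0 ≠ 0)
    (hd : dualPoly σ χ = χ) : χ.coeff 0 * σ (χ.coeff 0) = 1 := by
  have := map_coeff_of_dualPoly_eq_self h0 hd le_rfl
  rw [hχ.coeff_natDegree, map_one, Nat.sub_self] at this
  rw [mul_comm, ← this]

namespace IsToeplitzParameter

variable {p : F[X]} {l : ℕ} {x : F}

theorem ne_zero (hmon : p.Monic) (hirr : Irreducible p) (hx : IsToeplitzParameter σ p (p ^ l) x) :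
    x ≠ 0 := by
  rcases hx with ⟨_, rfl⟩ | ⟨⟨_, hp⟩, rfl⟩ | ⟨_, _, e, he, rfl⟩
  · exact one_ne_zero
  · intro h
    rw [eval_pow] at h
    have hroot : p.IsRoot (-1) := eq_zero_of_pow_eq_zero h
    have hdeg : p.natDegree = 1 := natDegree_eq_of_degree_eq_some
      (degree_eq_one_of_irreducible_of_root hirr hroot)
    have hp' := eq_X_add_C_of_natDegree_eq_one hmon hdeg
    apply hp
    rw [hp', IsRoot.def] at hroot
    simp only [eval_add, eval_X, eval_C] at hroot
    rw [hp', show p.coeff 0 = 1 by linear_combination hroot]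
  · exact sub_ne_zero.2 he.symm

theorem add_mul_map_eq_zero (hσ : ∀ a, σ (σ a) = a) (hmon : p.Monic)
    (h0 : (p ^ l).coeff 0 ≠ 0)
    (hd : dualPoly σ (p ^ l) = p ^ l) (hodd : Odd (p ^ l).natDegree)
    (hx : IsToeplitzParameter σ p (p ^ l) x) : x + (p ^ l).coeff 0 * σ x = 0 := by
  rcases hx with ⟨⟨heven, _⟩, rfl⟩ | ⟨_, rfl⟩ | ⟨_, hp, e, he, rfl⟩
  · exact absurd hodd (Nat.not_odd_iff_even.2 heven)
  · rw [map_eval_neg_one h0 hd, hodd.neg_one_pow]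
    linear_combination
      -(eval (-1) (p ^ l)) * coeff_zero_mul_map_coeff_zero (hmon.pow l) h0 hd
  · have hp1 : p = X + C 1 := by
      by_contra hne
      exact hp ⟨hodd, hne⟩
    have hc : (p ^ l).coeff 0 = 1 := by
      rw [hp1, coeff_zero_eq_eval_zero]; simp
    rw [hc, map_sub, hσ]
    ring

theorem add_map_mul_ne_zero (hchar : (2 : F) ≠ 0) (hσ : ∀ a, σ (σ a) = a) (hmon : p.Monic)
    (heven : Even (p ^ l).natDegree) (hdeg : p.natDegree = 1)
    (hx : IsToeplitzParameter σ p (p ^ l) x) : x + σ x * p.coeff 0 ^ (l - 1) ≠ 0 := by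
  have hn : (p ^ l).natDegree = l := by rw [natDegree_pow, hdeg, mul_one]
  rcases hx with ⟨⟨_, hp⟩, rfl⟩ | ⟨⟨hodd, _⟩, rfl⟩ | ⟨hp, _, e, he, rfl⟩
  · intro h
    refine hp ⟨p.coeff 0, eq_X_add_C_of_natDegree_eq_one hmon hdeg, ?_⟩
    rw [hn]
    rw [map_one, one_mul] at h
    linear_combination h
  · exact absurd hodd (Nat.not_odd_iff_even.2 heven)
  · obtain ⟨c, hc, hpow⟩ : ∃ c : F, p = X + C c ∧ c ^ ((p ^ l).natDegree - 1) = -1 := by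
      by_contra hne
      exact hp ⟨heven, hne⟩
    have hc0 : p.coeff 0 = c := by rw [hc]; simp
    rw [hn] at hpow
    rw [hc0, hpow, map_sub, hσ]
    have h2 : e - σ e + (σ e - e) * -1 = 2 * (e - σ e) := by ring
    rw [h2]
    exact mul_ne_zero hchar (sub_ne_zero.2 he.symm)

end IsToeplitzParameter

theorem exists_isToeplitzParameter {p : F[X]} {l : ℕ} (h0 : p.coeff 0 ≠ 0) (hmon : p.Monic)
    (hn : 0 < (p ^ l).natDegree)
    (hd : dualPoly σ p = p)
    (hid : σ = RingHom.id F → p ≠ X + C ((-1 : F) ^ ((p ^ l).natDegree + 1))) :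
    ∃ x, IsToeplitzParameter σ p (p ^ l) x := by
  by_cases h1 : Even (p ^ l).natDegree ∧ ¬ ∃ c : F, p = X + C c ∧ c ^ ((p ^ l).natDegree - 1) = -1
  · exact ⟨1, Or.inl ⟨h1, rfl⟩⟩
  by_cases h2 : Odd (p ^ l).natDegree ∧ p ≠ X + C 1
  · exact ⟨_, Or.inr (Or.inl ⟨h2, rfl⟩)⟩
  by_cases h3 : ∃ e : F, σ e ≠ e
  · obtain ⟨e, he⟩ := h3
    exact ⟨_, Or.inr (Or.inr ⟨h1, h2, e, he, rfl⟩)⟩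
  exfalso
  push Not at h3
  have hσid : σ = RingHom.id F := RingHom.ext h3
  apply hid hσid
  rcases Nat.even_or_odd (p ^ l).natDegree with heven | hodd
  · obtain ⟨c, hc, hpow⟩ : ∃ c : F, p = X + C c ∧ c ^ ((p ^ l).natDegree - 1) = -1 := by
      by_contra hne
      exact h1 ⟨heven, hne⟩
    have hc0 : p.coeff 0 = c := by rw [hc]; simp
    have hcc := coeff_zero_mul_map_coeff_zero hmon h0 hd
    rw [hc0, h3] at hcc
    obtain ⟨r, hr⟩ := heven
    obtain ⟨k, rfl⟩ : ∃ k, r = k + 1 := ⟨r - 1, by omega⟩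
    have hk : (p ^ l).natDegree - 1 = 2 * k + 1 := by omega
    rw [hk, pow_succ, pow_mul, sq, hcc, one_pow, one_mul] at hpow
    have hk' : (p ^ l).natDegree + 1 = 2 * (k + 1) + 1 := by omega
    rw [hk', pow_succ, pow_mul, neg_one_sq, one_pow, one_mul, ← hpow]
    exact hc
  · have hp1 : p = X + C 1 := by
      by_contra hne
      exact h2 ⟨hodd, hne⟩
    rw [hodd.add_one.neg_one_pow]
    exact hp1

theorem toeplitz_isUnit_det_and_eq_ctr_mul (hchar : (2 : F) ≠ 0) (hσ : ∀ a, σ (σ a) = a)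
    {p : F[X]} {l : ℕ} (hmon : p.Monic) (hirr : Irreducible p) (hl : 0 < l)
    (h0 : p.coeff 0 ≠ 0) (hd : dualPoly σ p = p) {x : F}
    (hx : IsToeplitzParameter σ p (p ^ l) x) {a : ℤ → F} {m : ℕ}
    (hm : m = ((p ^ l).natDegree + 1) / 2)
    (ha1 : a (1 - m) = x) (ha2 : a m = σ x)
    (hfrag : ∀ j : ℤ, 1 - m < j → j < (m : ℤ) → a j = 0)
    (hrec : ∀ t : ℤ, 1 - ((p ^ l).natDegree : ℤ) ≤ t →
      t + (p ^ l).natDegree ≤ ((p ^ l).natDegree : ℤ) - 1 →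
      ∑ s ∈ Finset.range ((p ^ l).natDegree + 1),
        (p ^ l).coeff ((p ^ l).natDegree - s) * a (t + s) = 0) :
    IsUnit (Matrix.det (Matrix.of fun i j : Fin (p ^ l).natDegree => a ((i : ℤ) - (j : ℤ)))) ∧
      (Matrix.of fun i j : Fin (p ^ l).natDegree => a ((i : ℤ) - (j : ℤ))) =
        ctr σ (Matrix.of fun i j : Fin (p ^ l).natDegree => a ((i : ℤ) - (j : ℤ))) *
          companion F (p ^ l) := by
  have hn : 0 < (p ^ l).natDegree := by
    rw [natDegree_pow]; exact Nat.mul_pos hl hirr.natDegree_pos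
  have h0l : (p ^ l).coeff 0 ≠ 0 := by
    rw [coeff_zero_eq_eval_zero, eval_pow, ← coeff_zero_eq_eval_zero]
    exact pow_ne_zero l h0
  have hdl : dualPoly σ (p ^ l) = p ^ l := by rw [dualPoly_pow, hd]
  have hsymm : ∀ j : ℤ, 1 - (m : ℤ) ≤ j → j ≤ m → σ (a j) = a (1 - j) := by
    intro j hj1 hj2
    by_cases hjl : j = 1 - m
    · rw [hjl, sub_sub_cancel, ha1, ha2]
    by_cases hjr : j = m
    · rw [hjr, ha1, ha2, hσ]
    rw [hfrag j (by omega) (by omega), hfrag (1 - j) (by omega) (by omega), map_zero]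
  have hM := toeplitz_eq_ctr_mul_companion (σ := σ) (hmon.pow l) h0l hdl (a := a) ?_ ?_ hrec
  · refine ⟨isUnit_iff_ne_zero.2 ?_, hM⟩
    refine toeplitz_det_ne_zero (m := m) hmon hirr hl h0 rfl (eq_ctr_mul_mul_of_eq_ctr_mul hσ hM)
      (by omega) hfrag ?_ ?_
    · rw [ha1]; exact hx.ne_zero hmon hirr
    · intro h2m hdeg
      rw [ha1, ha2]
      exact hx.add_map_mul_ne_zero hchar hσ hmon (even_iff_two_dvd.2 ⟨m, h2m.symm⟩) hdeg
  · intro h1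
    have hm0 : (0 : ℤ) = 1 - m := by omega
    rw [hm0, ha1]
    exact hx.add_mul_map_eq_zero hσ hmon h0l hdl (h1 ▸ odd_one)
  · intro k hk1 hk2
    exact map_eq_of_recurrent hσ (hmon.pow l) h0l hdl (by omega) (by omega) hsymm hrec hk1 hk2

theorem exists_toeplitz_sequence {χ : F[X]} (hχ : χ.Monic) (hn : 0 < χ.natDegree)
    (h0 : χ.coeff 0 ≠ 0) {x y : F} (hxy : Odd χ.natDegree → x + χ.coeff 0 * y = 0) {m : ℕ}
    (hm : m = (χ.natDegree + 1) / 2) :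
    ∃ a : ℤ → F, a (1 - m) = x ∧ a m = y ∧ (∀ j : ℤ, 1 - m < j → j < (m : ℤ) → a j = 0) ∧
      ∀ t : ℤ, ∑ s ∈ Finset.range (χ.natDegree + 1),
        χ.coeff (χ.natDegree - s) * a (t + s) = 0 := by
  obtain ⟨a, hrec, ha⟩ := exists_recurrent_extension hχ hn h0 (1 - m)
    (fun j => if j = 0 then x else if j + 1 = 2 * m then y else 0)
  have h1 : a (1 - m) = x := by simpa using ha 0 hn
  have hmid : ∀ j : ℤ, 1 - m < j → j < (m : ℤ) → a j = 0 := by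
    intro j hj1 hj2
    have := ha (j - (1 - m)).toNat (by omega)
    rwa [if_neg (by omega), if_neg (by omega),
      show (1 - (m : ℤ)) + ((j - (1 - m)).toNat : ℤ) = j by omega] at this
  refine ⟨a, h1, ?_, hmid, hrec⟩
  rcases Nat.even_or_odd' χ.natDegree with ⟨k, hk | hk⟩
  · have := ha (χ.natDegree - 1) (by omega)
    rwa [if_neg (by omega), if_pos (by omega),
      show (1 - (m : ℤ)) + ((χ.natDegree - 1 : ℕ) : ℤ) = m by omega] at this
  · have hr := hrec (1 - m)
    rw [Finset.sum_range_succ, Finset.sum_eq_single 0] at hr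
    · rw [show (1 - (m : ℤ)) + (χ.natDegree : ℤ) = m by omega] at hr
      simp only [Nat.cast_zero, add_zero, Nat.sub_zero, Nat.sub_self, h1, hχ.coeff_natDegree,
        one_mul] at hr
      refine mul_left_cancel₀ h0 ?_
      linear_combination hr - hxy ⟨k, hk⟩
    · intro s hs hs0
      have hs' := Finset.mem_range.1 hs
      rw [hmid _ (by omega) (by omega), mul_zero]
    · intro h
      exact absurd (Finset.mem_range.2 hn) h

end ToeplitzParameter


section Stmt17
variable {F : Type*} [Field F]

theorem stmt17 (F : Type*) [Field F] (hchar : (2 : F) ≠ 0)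
    (σ : F →+* F) (hσinv : ∀ a, σ (σ a) = a)
    (pp : Polynomial F) (l : ℕ) (hmon : pp.Monic) (hirr : Irreducible pp) (hl : 0 < l)
    (hns : (pp ^ l).eval 0 ≠ 0) :
    -- existence criterion
    ((∃ M : Mat F (pp ^ l).natDegree, IsUnit M.det ∧ M = ctr σ M * companion F (pp ^ l)) ↔
      (dualPoly σ pp = pp ∧
        (σ = RingHom.id F → pp ≠ X + C ((-1 : F) ^ ((pp ^ l).natDegree + 1))))) ∧
    -- explicit construction
    (dualPoly σ pp = pp →
      (σ = RingHom.id F → pp ≠ X + C ((-1 : F) ^ ((pp ^ l).natDegree + 1))) →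
      ∀ aval : F,
        (((Even (pp ^ l).natDegree ∧
            ¬ ∃ c : F, pp = X + C c ∧ c ^ ((pp ^ l).natDegree - 1) = -1) ∧ aval = 1) ∨
         ((Odd (pp ^ l).natDegree ∧ pp ≠ X + C 1) ∧ aval = (pp ^ l).eval (-1)) ∨
         (¬ (Even (pp ^ l).natDegree ∧
              ¬ ∃ c : F, pp = X + C c ∧ c ^ ((pp ^ l).natDegree - 1) = -1) ∧
          ¬ (Odd (pp ^ l).natDegree ∧ pp ≠ X + C 1) ∧
          ∃ e : F, σ e ≠ e ∧ aval = e - σ e)) →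
      ∀ a : ℤ → F,
        -- the fragment (a_{1−m}, …, a_m) = (aval, 0, …, 0, σ aval), 2m = n or n+1
        (a (1 - (((pp ^ l).natDegree + 1) / 2 : ℕ)) = aval ∧
         a ((((pp ^ l).natDegree + 1) / 2 : ℕ) : ℤ) = σ aval ∧
         ∀ j : ℤ, 1 - (((pp ^ l).natDegree + 1) / 2 : ℕ) < j →
           j < ((((pp ^ l).natDegree + 1) / 2 : ℕ) : ℤ) → a j = 0) →
        -- the vector (a_{1−n}, …, a_{n−1}) is χ_Φ-recurrent
        (∀ t : ℤ, 1 - ((pp ^ l).natDegree : ℤ) ≤ t →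
           t + (pp ^ l).natDegree ≤ ((pp ^ l).natDegree : ℤ) - 1 →
           ∑ s ∈ Finset.range ((pp ^ l).natDegree + 1),
             (pp ^ l).coeff ((pp ^ l).natDegree - s) * a (t + s) = 0) →
        -- then the Toeplitz matrix [a_{i−j}] is a valid choice of √*Φ
        IsUnit (Matrix.det (Matrix.of fun i j : Fin (pp ^ l).natDegree =>
          a ((i : ℤ) - (j : ℤ)))) ∧
        (Matrix.of fun i j : Fin (pp ^ l).natDegree => a ((i : ℤ) - (j : ℤ))) =
          ctr σ (Matrix.of fun i j : Fin (pp ^ l).natDegree => a ((i : ℤ) - (j : ℤ))) *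
            companion F (pp ^ l)) := by
  have h0 : pp.coeff 0 ≠ 0 := by
    rw [coeff_zero_eq_eval_zero]
    intro h
    exact hns (by rw [eval_pow, h, zero_pow hl.ne'])
  have h0l : (pp ^ l).coeff 0 ≠ 0 := by rwa [coeff_zero_eq_eval_zero]
  have hdeg : (pp ^ l).natDegree = l * pp.natDegree := natDegree_pow pp l
  have hn : 0 < (pp ^ l).natDegree := by rw [hdeg]; exact Nat.mul_pos hl hirr.natDegree_pos
  refine ⟨⟨?_, ?_⟩, ?_⟩
  · rintro ⟨M, hM, h⟩
    refine ⟨dualPoly_eq_self_of_eq_ctr_mul hσinv hmon hirr hl h0 hM h, ?_⟩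
    rintro rfl hpp
    have hl' : (pp ^ l).natDegree = l := by
      have : pp.natDegree = 1 := by rw [hpp]; exact natDegree_X_add_C _
      rw [hdeg, this, mul_one]
    refine hM.ne_zero
      (det_eq_zero_of_eq_transpose_mul_companion hchar (hmon.pow l) hn ?_ (M := M) ?_)
    · rw [← hpp, hl']
    · simpa [ctr] using h
  · rintro ⟨hd, hid⟩
    obtain ⟨x, hx⟩ := exists_isToeplitzParameter h0 hmon hn hd hid
    have hdl : dualPoly σ (pp ^ l) = pp ^ l := by rw [dualPoly_pow, hd]
    obtain ⟨a, ha1, ha2, hfrag, hrec⟩ := exists_toeplitz_sequence (hmon.pow l) hn h0l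
      (fun hodd => hx.add_mul_map_eq_zero hσinv hmon h0l hdl hodd) rfl
    exact ⟨_, toeplitz_isUnit_det_and_eq_ctr_mul hchar hσinv hmon hirr hl h0 hd hx rfl ha1 ha2
      hfrag fun t _ _ => hrec t⟩
  · intro hd _ aval hx a ha hrec
    exact toeplitz_isUnit_det_and_eq_ctr_mul hchar hσinv hmon hirr hl h0 hd hx rfl ha.1 ha.2.1
      ha.2.2 hrec

end Stmt17
end
end Can
end
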